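/- arXiv:2409.06303 — 4 statements merged into one kernel-verified Lean document; each statement's English description precedes it below -/
import Mathlib

section
/- Let n ≥ 1 and work in the Lie algebra gl_n(ℂ) = M_n(ℂ). Let e = Σ_{i=1}^{n−1} E_{i,i+1}, f = Σ_{i=1}^{n−1} i(n−i) E_{i+1,i}, and h = diag(n−1, n−3, …, 3−n, 1−n), where E_{i,j} denotes the elementary matrix. Then (e, h, f) satisfies [h, e] = 2e, [h, f] = −2f, [e, f] = h, and the map from the affine subspace e + ker(ad f) ⊆ M_n(ℂ) to the set of monic polynomials of degree n over ℂ, sending a matrix to its characteristic polynomial, is a bijection. Here ker(ad f) = { X ∈ M_n(ℂ) : fX − Xf = 0 }. -/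
open Matrix

/-- The principal nilpotent `e = Σ E_{i,i+1}` in `gl_n(ℂ)` (0-indexed). -/
def prinE (n : ℕ) : Matrix (Fin n) (Fin n) ℂ :=
  Matrix.of fun i j => if (i : ℕ) + 1 = (j : ℕ) then 1 else 0

/-- The element `f = Σ_{i=1}^{n-1} i(n-i) E_{i+1,i}` in `gl_n(ℂ)` (0-indexed:
the entry in row `j+1`, column `j` is `(j+1)(n-(j+1))`). -/
def prinF (n : ℕ) : Matrix (Fin n) (Fin n) ℂ :=
  Matrix.of fun i j =>
    if (j : ℕ) + 1 = (i : ℕ) then (((j : ℕ) + 1 : ℂ) * ((n : ℂ) - ((j : ℕ) + 1 : ℂ))) else 0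

/-- The semisimple element `h = diag(n-1, n-3, …, 1-n)` in `gl_n(ℂ)`. -/
def prinH (n : ℕ) : Matrix (Fin n) (Fin n) ℂ :=
  Matrix.diagonal fun i => (n : ℂ) - 1 - 2 * (i : ℕ)

open Polynomial in
/-- The monic polynomials `p i` attached to the lower Hessenberg matrix with ones on the
superdiagonal and `a l * w i l` at position `(i, i - l)`: the last one is its characteristic
polynomial. -/
noncomputable def hessenbergPoly {R : Type*} [CommRing R] (w : ℕ → ℕ → R) (a : ℕ → R) : ℕ → R[X]
  | 0 => 1
  | i + 1 => X * hessenbergPoly w a i -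
      ∑ l : Fin (i + 1), C (a l * w i l) * hessenbergPoly w a (i - l)
  decreasing_by all_goals omega

section HessenbergPoly

open Polynomial

variable {R : Type*} [CommRing R] (w : ℕ → ℕ → R)

theorem hessenbergPoly_zero (a : ℕ → R) : hessenbergPoly w a 0 = 1 := by
  rw [hessenbergPoly]

theorem hessenbergPoly_succ (a : ℕ → R) (i : ℕ) :
    hessenbergPoly w a (i + 1) = X * hessenbergPoly w a i -
      ∑ l ∈ Finset.range (i + 1), C (a l * w i l) * hessenbergPoly w a (i - l) := by
  rw [hessenbergPoly, Finset.sum_range]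

theorem hessenbergPoly_coeff (a : ℕ → R) (i : ℕ) :
    (hessenbergPoly w a i).coeff i = 1 ∧ ∀ r, i < r → (hessenbergPoly w a i).coeff r = 0 := by
  induction i using Nat.strong_induction_on with
  | _ i ih =>
    rcases i with _ | i
    · rw [hessenbergPoly_zero]
      refine ⟨by simp, fun r hr => ?_⟩
      rw [coeff_one, if_neg (by omega)]
    · have hsum : ∀ r, i < r → (∑ l ∈ Finset.range (i + 1),
          C (a l * w i l) * hessenbergPoly w a (i - l)).coeff r = 0 := by
        intro r hr
        rw [finsetSum_coeff]
        refine Finset.sum_eq_zero fun l _ => ?_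
        rw [coeff_C_mul, (ih (i - l) (by omega)).2 r (by omega), mul_zero]
      rw [hessenbergPoly_succ]
      refine ⟨?_, fun r hr => ?_⟩
      · rw [coeff_sub, hsum _ (by omega), coeff_X_mul, (ih i (by omega)).1, sub_zero]
      · obtain ⟨r, rfl⟩ : ∃ s, r = s + 1 := ⟨r - 1, by omega⟩
        rw [coeff_sub, hsum _ (by omega), coeff_X_mul, (ih i (by omega)).2 r (by omega), sub_zero]

/-- If two parameter sequences agree below `k`, the corresponding polynomials agree in the top
`k + 1` coefficients, and the next coefficients differ by an explicit multiple of `a k - b k`. -/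
theorem hessenbergPoly_coeff_sub {a b : ℕ → R} {k : ℕ} (hab : ∀ l < k, a l = b l) (i : ℕ) :
    (∀ r, i ≤ r + k →
      (hessenbergPoly w a i).coeff r - (hessenbergPoly w b i).coeff r = 0) ∧
    ∀ r, r + k + 1 = i →
      (hessenbergPoly w a i).coeff r - (hessenbergPoly w b i).coeff r =
        -((a k - b k) * ∑ j ∈ Finset.Ico k i, w j k) := by
  induction i using Nat.strong_induction_on with
  | _ i ih =>
    rcases i with _ | i
    · simp [hessenbergPoly_zero]
    · have hterm : ∀ r, i ≤ r + k → ∀ l ∈ Finset.range (i + 1), l ≠ k →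
          (C (a l * w i l) * hessenbergPoly w a (i - l)).coeff r -
            (C (b l * w i l) * hessenbergPoly w b (i - l)).coeff r = 0 := by
        intro r hr l hl hlk
        rw [Finset.mem_range] at hl
        rw [coeff_C_mul, coeff_C_mul]
        rcases lt_or_gt_of_ne hlk with h | h
        · rw [hab l h, ← mul_sub, (ih (i - l) (by omega)).1 r (by omega), mul_zero]
        · rw [(hessenbergPoly_coeff w a _).2 r (by omega),
            (hessenbergPoly_coeff w b _).2 r (by omega)]
          simp
      rw [hessenbergPoly_succ, hessenbergPoly_succ]
      refine ⟨fun r hr => ?_, fun r hr => ?_⟩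
      · have hX : (X * hessenbergPoly w a i).coeff r - (X * hessenbergPoly w b i).coeff r = 0 := by
          rcases r with _ | r
          · simp
          · rw [coeff_X_mul, coeff_X_mul, (ih i (by omega)).1 r (by omega)]
        have hS : ∑ l ∈ Finset.range (i + 1),
            ((C (a l * w i l) * hessenbergPoly w a (i - l)).coeff r -
              (C (b l * w i l) * hessenbergPoly w b (i - l)).coeff r) = 0 := by
          refine Finset.sum_eq_zero fun l hl => ?_
          by_cases hlk : l = k
          · subst hlk
            rw [Finset.mem_range] at hl
            rw [coeff_C_mul, coeff_C_mul, (hessenbergPoly_coeff w a _).2 r (by omega),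
              (hessenbergPoly_coeff w b _).2 r (by omega)]
            simp
          · exact hterm r (by omega) l hl hlk
        rw [Finset.sum_sub_distrib] at hS
        rw [coeff_sub, coeff_sub, finsetSum_coeff, finsetSum_coeff]
        linear_combination hX - hS
      · have hX : (X * hessenbergPoly w a i).coeff r - (X * hessenbergPoly w b i).coeff r =
            -((a k - b k) * ∑ j ∈ Finset.Ico k i, w j k) := by
          rcases r with _ | r
          · simp [show i = k by omega]
          · rw [coeff_X_mul, coeff_X_mul, (ih i (by omega)).2 r (by omega)]
        have hS : ∑ l ∈ Finset.range (i + 1),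
            ((C (a l * w i l) * hessenbergPoly w a (i - l)).coeff r -
              (C (b l * w i l) * hessenbergPoly w b (i - l)).coeff r) = (a k - b k) * w i k := by
          rw [Finset.sum_eq_single_of_mem k (by rw [Finset.mem_range]; omega)
            (hterm r (by omega)), coeff_C_mul, coeff_C_mul, show i - k = r by omega,
            (hessenbergPoly_coeff w a _).1, (hessenbergPoly_coeff w b _).1]
          ring
        rw [Finset.sum_sub_distrib] at hS
        rw [coeff_sub, coeff_sub, finsetSum_coeff, finsetSum_coeff,
          Finset.sum_Ico_succ_top (by omega)]
        linear_combination hX - hS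

/-- A polynomial with the degree and leading coefficient of `hessenbergPoly w a n` equals it as soon
as the lower coefficients agree. -/
theorem eq_hessenbergPoly (a : ℕ → R) {n : ℕ} {p : R[X]} (hp : p.Monic) (hpn : p.natDegree = n)
    (h : ∀ k < n, (hessenbergPoly w a n).coeff (n - 1 - k) = p.coeff (n - 1 - k)) :
    hessenbergPoly w a n = p := by
  ext r
  rcases lt_trichotomy r n with hr | rfl | hr
  · have := h (n - 1 - r) (by omega)
    rwa [show n - 1 - (n - 1 - r) = r by omega] at this
  · rw [(hessenbergPoly_coeff w a _).1, ← hpn, hp.coeff_natDegree]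
  · rw [(hessenbergPoly_coeff w a n).2 r hr, coeff_eq_zero_of_natDegree_lt (by omega)]

theorem hessenbergPoly_injective [NoZeroDivisors R] {n : ℕ}
    (hw : ∀ k < n, ∑ j ∈ Finset.Ico k n, w j k ≠ 0) {a b : ℕ → R}
    (hab : hessenbergPoly w a n = hessenbergPoly w b n) : ∀ k < n, a k = b k := by
  intro k
  induction k using Nat.strong_induction_on with
  | _ k ih =>
    intro hk
    have h := (hessenbergPoly_coeff_sub w (fun l hl => ih l hl (by omega)) n).2 (n - 1 - k)
      (by omega)
    rw [hab, sub_self, eq_comm, neg_eq_zero] at h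
    exact sub_eq_zero.1 ((mul_eq_zero.1 h).resolve_right (hw k hk))

theorem hessenbergPoly_surjective {K : Type*} [Field K] (w : ℕ → ℕ → K) {n : ℕ}
    (hw : ∀ k < n, ∑ j ∈ Finset.Ico k n, w j k ≠ 0) {p : K[X]} (hp : p.Monic)
    (hpn : p.natDegree = n) : ∃ a : ℕ → K, hessenbergPoly w a n = p := by
  suffices h : ∀ m ≤ n, ∃ a : ℕ → K,
      ∀ k < m, (hessenbergPoly w a n).coeff (n - 1 - k) = p.coeff (n - 1 - k) by
    obtain ⟨a, ha⟩ := h n le_rfl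
    exact ⟨a, eq_hessenbergPoly w a hp hpn ha⟩
  intro m
  induction m with
  | zero => exact fun _ => ⟨0, by simp⟩
  | succ m ih =>
    intro hm
    obtain ⟨a, ha⟩ := ih (by omega)
    let S := ∑ j ∈ Finset.Ico m n, w j m
    let d := ((hessenbergPoly w a n).coeff (n - 1 - m) - p.coeff (n - 1 - m)) / S
    have hd : d * S = (hessenbergPoly w a n).coeff (n - 1 - m) - p.coeff (n - 1 - m) :=
      div_mul_cancel₀ _ (hw m (by omega))
    have hagree : ∀ l < m, Function.update a m (a m + d) l = a l := fun l hl =>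
      Function.update_of_ne (by omega) _ _
    have hdiff := hessenbergPoly_coeff_sub w hagree n
    refine ⟨Function.update a m (a m + d), fun k hk => ?_⟩
    rcases Nat.lt_succ_iff_lt_or_eq.1 hk with hk | rfl
    · rw [← ha k hk]
      exact sub_eq_zero.1 (hdiff.1 _ (by omega))
    · have h := hdiff.2 (n - 1 - k) (by omega)
      rw [Function.update_self, add_sub_cancel_left] at h
      linear_combination h - hd

end HessenbergPoly

section Hessenberg

open Polynomial

variable {R : Type*} [CommRing R] {n : ℕ} [NeZero n] {M : Matrix (Fin n) (Fin n) R}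

/-- The first row of the `d`-th power of a lower Hessenberg matrix with unit superdiagonal. -/
theorem hessenberg_pow_zero_apply (h₁ : ∀ i j : Fin n, (i : ℕ) + 1 = j → M i j = 1)
    (h₀ : ∀ i j : Fin n, (i : ℕ) + 1 < j → M i j = 0) (d : ℕ) (j : Fin n) (hj : d ≤ j) :
    (M ^ d) 0 j = if (j : ℕ) = d then 1 else 0 := by
  induction d generalizing j with
  | zero =>
    rw [pow_zero, Matrix.one_apply]
    exact if_congr (by rw [Fin.ext_iff, Fin.val_zero, eq_comm]) rfl rfl
  | succ d ih =>
    have hd : d < n := by omega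
    rw [pow_succ, Matrix.mul_apply, Finset.sum_eq_single ⟨d, hd⟩]
    · rw [ih ⟨d, hd⟩ le_rfl, if_pos rfl, one_mul]
      split_ifs with h
      · exact h₁ _ _ h.symm
      · exact h₀ _ _ (by simp only; omega)
    · intro k _ hk
      have hk' : (k : ℕ) ≠ d := fun h => hk (Fin.ext h)
      rcases lt_or_gt_of_ne hk' with h | h
      · rw [h₀ k j (by omega), mul_zero]
      · rw [ih k (by omega), if_neg hk', zero_mul]
    · simp

/-- The first coordinate row vector is cyclic for a lower Hessenberg matrix. -/
theorem hessenberg_eq_zero_of_aeval (h₁ : ∀ i j : Fin n, (i : ℕ) + 1 = j → M i j = 1)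
    (h₀ : ∀ i j : Fin n, (i : ℕ) + 1 < j → M i j = 0) {q : R[X]} (hq : ∀ r, n ≤ r → q.coeff r = 0)
    (h : ∀ j, (aeval M q) 0 j = 0) : q = 0 := by
  by_contra hne
  have hd : q.natDegree < n := by
    by_contra hle
    exact hne (leadingCoeff_eq_zero.1 (hq _ (by omega)))
  have key := h ⟨q.natDegree, hd⟩
  rw [aeval_eq_sum_range, Matrix.sum_apply, Finset.sum_eq_single q.natDegree] at key
  · rw [Matrix.smul_apply, hessenberg_pow_zero_apply h₁ h₀ q.natDegree _ le_rfl, if_pos rfl, smul_eq_mul,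
      mul_one] at key
    exact hne (leadingCoeff_eq_zero.1 key)
  · intro r hr hne'
    rw [Finset.mem_range] at hr
    rw [Matrix.smul_apply, hessenberg_pow_zero_apply h₁ h₀ _ _ (by simp only; omega),
      if_neg (by simp only; omega), smul_zero]
  · simp

/-- The characteristic polynomial of a lower Hessenberg matrix with unit superdiagonal. -/
theorem charpoly_eq_hessenbergPoly [Nontrivial R] (w : ℕ → ℕ → R) (a : ℕ → R)
    (hM : ∀ i j : Fin n, M i j = if (i : ℕ) + 1 = j then 1 else
      if (j : ℕ) ≤ i then a (i - j) * w i (i - j) else 0) :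
    M.charpoly = hessenbergPoly w a n := by
  have hrow : ∀ i ≤ n, ∀ j : Fin n,
      (aeval M (hessenbergPoly w a i)) 0 j = if i = (j : ℕ) then 1 else 0 := by
    intro i
    induction i using Nat.strong_induction_on with
    | _ i ih =>
      intro hi j
      rcases i with _ | i
      · rw [hessenbergPoly_zero, map_one, Matrix.one_apply]
        simp [Fin.ext_iff]
      · have hX : (aeval M (hessenbergPoly w a i) * M) 0 j = M ⟨i, hi⟩ j := by
          rw [Matrix.mul_apply, Finset.sum_eq_single ⟨i, hi⟩]
          · rw [ih i (by omega) (by omega), if_pos rfl, one_mul]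
          · intro k _ hk
            rw [ih i (by omega) (by omega), if_neg fun h => hk (Fin.ext h.symm), zero_mul]
          · simp
        have hS : ∑ l ∈ Finset.range (i + 1),
            (aeval M (C (a l * w i l) * hessenbergPoly w a (i - l))) 0 j =
              if (j : ℕ) ≤ i then a (i - j) * w i (i - j) else 0 := by
          have hterm : ∀ l ∈ Finset.range (i + 1),
              (aeval M (C (a l * w i l) * hessenbergPoly w a (i - l))) 0 j =
                a l * w i l * if i - l = (j : ℕ) then 1 else 0 := by
            intro l _
            rw [map_mul, aeval_C, ← Algebra.smul_def, Matrix.smul_apply,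
              ih (i - l) (by omega) (by omega), smul_eq_mul]
          rw [Finset.sum_congr rfl hterm]
          split_ifs with hj
          · rw [Finset.sum_eq_single_of_mem (i - j) (by rw [Finset.mem_range]; omega),
              if_pos (by omega), mul_one]
            intro l hl hlj
            rw [Finset.mem_range] at hl
            rw [if_neg (by omega), mul_zero]
          · exact Finset.sum_eq_zero fun l _ => by rw [if_neg (by omega), mul_zero]
        rw [hessenbergPoly_succ, mul_comm X, map_sub, map_mul, aeval_X, map_sum, Matrix.sub_apply,
          Matrix.sum_apply, hX, hS, hM]
        simp only
        split_ifs <;> first | omega | simp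
  refine sub_eq_zero.1 (hessenberg_eq_zero_of_aeval (M := M) ?_ ?_ ?_ ?_)
  · exact fun i j h => by rw [hM, if_pos h]
  · exact fun i j h => by rw [hM, if_neg (by omega), if_neg (by omega)]
  · intro r hr
    have hdeg : M.charpoly.natDegree = n := by simp [Matrix.charpoly_natDegree_eq_dim]
    rw [coeff_sub]
    rcases hr.eq_or_lt with rfl | hr
    · have := M.charpoly_monic.coeff_natDegree
      rw [hdeg] at this
      rw [(hessenbergPoly_coeff w a _).1, this, sub_self]
    · rw [(hessenbergPoly_coeff w a n).2 r hr, coeff_eq_zero_of_natDegree_lt (by omega), sub_self]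
  · intro j
    rw [map_sub, Matrix.aeval_self_charpoly, Matrix.sub_apply, hrow n le_rfl,
      if_neg (by omega), Matrix.zero_apply, sub_zero]

end Hessenberg

section Principal

variable {n : ℕ}

theorem prinE_mul_apply (A : Matrix (Fin n) (Fin n) ℂ) (i j : Fin n) :
    (prinE n * A) i j = if h : (i : ℕ) + 1 < n then A ⟨i + 1, h⟩ j else 0 := by
  rw [Matrix.mul_apply]
  split_ifs with h
  · rw [Finset.sum_eq_single ⟨i + 1, h⟩]
    · simp [prinE]
    · intro k _ hk
      rw [prinE, Matrix.of_apply, if_neg fun h' => hk (Fin.ext h'.symm), zero_mul]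
    · simp
  · refine Finset.sum_eq_zero fun k _ => ?_
    rw [prinE, Matrix.of_apply, if_neg (by omega), zero_mul]

theorem mul_prinE_apply_succ (A : Matrix (Fin n) (Fin n) ℂ) (i j k : Fin n)
    (hk : (k : ℕ) + 1 = j) : (A * prinE n) i j = A i k := by
  rw [Matrix.mul_apply, Finset.sum_eq_single k]
  · rw [prinE, Matrix.of_apply, if_pos hk, mul_one]
  · intro l _ hl
    rw [prinE, Matrix.of_apply, if_neg fun h => hl (Fin.ext (by omega)), mul_zero]
  · simp

theorem mul_prinE_apply_of_eq_zero (A : Matrix (Fin n) (Fin n) ℂ) (i j : Fin n)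
    (hj : (j : ℕ) = 0) : (A * prinE n) i j = 0 := by
  rw [Matrix.mul_apply]
  refine Finset.sum_eq_zero fun k _ => ?_
  rw [prinE, Matrix.of_apply, if_neg (by omega), mul_zero]

theorem prinH_commutator_prinE :
    prinH n * prinE n - prinE n * prinH n = (2 : ℂ) • prinE n := by
  ext i j
  rw [prinH, Matrix.sub_apply, Matrix.diagonal_mul, Matrix.mul_diagonal, Matrix.smul_apply, prinE,
    Matrix.of_apply]
  split_ifs with h
  · rw [← h, smul_eq_mul]
    push_cast
    ring
  · simp

theorem prinH_commutator_prinF :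
    prinH n * prinF n - prinF n * prinH n = (-2 : ℂ) • prinF n := by
  ext i j
  rw [prinH, Matrix.sub_apply, Matrix.diagonal_mul, Matrix.mul_diagonal, Matrix.smul_apply, prinF,
    Matrix.of_apply]
  split_ifs with h
  · rw [← h, smul_eq_mul]
    push_cast
    ring
  · simp

theorem prinE_commutator_prinF : prinE n * prinF n - prinF n * prinE n = prinH n := by
  ext i j
  have hEF : (prinE n * prinF n) i j =
      if i = j then ((j : ℕ) + 1 : ℂ) * ((n : ℂ) - ((j : ℕ) + 1 : ℂ)) else 0 := by
    rw [prinE_mul_apply]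
    split_ifs with h hij hij
    · simp [prinF, hij]
    · rw [prinF, Matrix.of_apply, if_neg fun h' => hij (Fin.ext (by simp only at h'; omega))]
    · have hn : (n : ℂ) = (j : ℕ) + 1 := by
        rw [← hij]
        exact_mod_cast (show n = i + 1 by omega)
      rw [hn, sub_self, mul_zero]
    · rfl
  have hFE : (prinF n * prinE n) i j =
      if i = j then ((j : ℕ) : ℂ) * ((n : ℂ) - ((j : ℕ) : ℂ)) else 0 := by
    by_cases hj : (j : ℕ) = 0
    · rw [mul_prinE_apply_of_eq_zero _ _ _ hj, hj]
      simp
    · have hk : ((⟨j - 1, by omega⟩ : Fin n) : ℕ) + 1 = j := by simp only; omega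
      rw [mul_prinE_apply_succ _ _ _ _ hk, prinF, Matrix.of_apply]
      have hc : (((⟨j - 1, by omega⟩ : Fin n) : ℕ) : ℂ) + 1 = (j : ℕ) := by exact_mod_cast hk
      rw [hk, hc]
      exact if_congr (by rw [Fin.ext_iff, eq_comm]) rfl rfl
  rw [Matrix.sub_apply, hEF, hFE, prinH, Matrix.diagonal_apply]
  split_ifs with h
  · subst h
    ring
  · simp

/-- The entry of `f ^ l` at position `(i, i - l)`. -/
def prinWeight (n i l : ℕ) : ℕ :=
  ∏ t ∈ Finset.range l, (i - t) * (n - (i - t))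

theorem prinWeight_pos {i l : ℕ} (hl : l ≤ i) (hi : i < n) : 0 < prinWeight n i l := by
  refine Finset.prod_pos fun t ht => ?_
  rw [Finset.mem_range] at ht
  exact Nat.mul_pos (by omega) (by omega)

theorem prinF_pow_apply (l : ℕ) (i j : Fin n) :
    (prinF n ^ l) i j = if (j : ℕ) + l = i then (prinWeight n i l : ℂ) else 0 := by
  induction l generalizing j with
  | zero =>
    rw [pow_zero, Matrix.one_apply]
    exact if_congr (by rw [Fin.ext_iff, add_zero, eq_comm]) (by simp [prinWeight]) rfl
  | succ l ih =>
    rw [pow_succ, Matrix.mul_apply]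
    by_cases hj : (j : ℕ) + 1 < n
    · rw [Finset.sum_eq_single ⟨j + 1, hj⟩]
      · rw [ih, prinF, Matrix.of_apply, if_pos rfl]
        simp only
        by_cases h : (j : ℕ) + 1 + l = i
        · rw [if_pos h, if_pos (by omega), prinWeight, prinWeight, Finset.prod_range_succ,
            show (i : ℕ) - l = j + 1 by omega, Nat.cast_mul, Nat.cast_mul, Nat.cast_sub hj.le]
          push_cast
          ring
        · rw [if_neg h, if_neg (by omega), zero_mul]
      · intro k _ hk
        rw [prinF, Matrix.of_apply, if_neg fun h => hk (Fin.ext h.symm), mul_zero]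
      · simp
    · rw [if_neg (by omega)]
      refine Finset.sum_eq_zero fun k _ => ?_
      rw [prinF, Matrix.of_apply, if_neg (by omega), mul_zero]

theorem sum_smul_prinF_pow_apply (a : ℕ → ℂ) (i j : Fin n) :
    (∑ l ∈ Finset.range n, a l • prinF n ^ l) i j =
      if (j : ℕ) ≤ i then a (i - j) * prinWeight n i (i - j) else 0 := by
  rw [Matrix.sum_apply]
  simp only [Matrix.smul_apply, prinF_pow_apply, smul_eq_mul]
  split_ifs with h
  · rw [Finset.sum_eq_single_of_mem ((i : ℕ) - j) (by rw [Finset.mem_range]; omega),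
      if_pos (by omega)]
    intro l _ hl
    rw [if_neg (by omega), mul_zero]
  · exact Finset.sum_eq_zero fun l _ => by rw [if_neg (by omega), mul_zero]

/-- The centralizer of `f` consists of the polynomials in `f`. -/
theorem exists_sum_smul_prinF_pow [NeZero n] {Y : Matrix (Fin n) (Fin n) ℂ}
    (hY : Commute (prinF n) Y) : ∃ a : ℕ → ℂ, Y = ∑ l ∈ Finset.range n, a l • prinF n ^ l := by
  let a : ℕ → ℂ := fun l => if h : l < n then Y ⟨l, h⟩ 0 / prinWeight n l l else 0
  refine ⟨a, sub_eq_zero.1 ?_⟩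
  set D := Y - ∑ l ∈ Finset.range n, a l • prinF n ^ l with hD
  have hcomm : Commute (prinF n) D := by
    refine hY.sub_right (Commute.sum_right _ _ _ fun l _ => ?_)
    exact ((Commute.refl (prinF n)).pow_right l).smul_right (a l)
  have hw : ∀ l : Fin n, (prinWeight n l l : ℂ) ≠ 0 := fun l =>
    Nat.cast_ne_zero.2 (prinWeight_pos le_rfl l.2).ne'
  have hcol : ∀ i, D i 0 = 0 := by
    intro i
    rw [hD, Matrix.sub_apply, sum_smul_prinF_pow_apply]
    simp [a, div_mul_cancel₀ _ (hw i)]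
  ext i l
  have h := congrFun (congrFun (hcomm.pow_left (l : ℕ)).eq i) 0
  rw [Matrix.mul_apply, Matrix.mul_apply, Finset.sum_eq_zero fun k _ => by rw [hcol, mul_zero],
    Finset.sum_eq_single l, prinF_pow_apply, if_pos (by simp)] at h
  · exact (mul_eq_zero.1 h.symm).resolve_right (hw l)
  · intro k _ hk
    rw [prinF_pow_apply, if_neg fun h' => hk (Fin.ext (by simpa using h'.symm)), mul_zero]
  · simp

theorem charpoly_prinE_add_sum [NeZero n] (a : ℕ → ℂ) :
    (prinE n + ∑ l ∈ Finset.range n, a l • prinF n ^ l).charpoly =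
      hessenbergPoly (fun i l => (prinWeight n i l : ℂ)) a n := by
  refine charpoly_eq_hessenbergPoly _ a fun i j => ?_
  rw [Matrix.add_apply, sum_smul_prinF_pow_apply, prinE, Matrix.of_apply]
  split_ifs <;> first | omega | simp

theorem sum_prinWeight_ne_zero (k : ℕ) (hk : k < n) :
    ∑ j ∈ Finset.Ico k n, (prinWeight n j k : ℂ) ≠ 0 := by
  rw [← Nat.cast_sum, Nat.cast_ne_zero]
  refine (Finset.sum_pos (fun j hj => ?_) ⟨k, Finset.mem_Ico.2 ⟨le_rfl, hk⟩⟩).ne'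
  rw [Finset.mem_Ico] at hj
  exact prinWeight_pos hj.1 hj.2

end Principal

/-- `(e, h, f)` is an `sl₂`-triple, and the characteristic
polynomial map from the Kostant–Slodowy slice `e + ker (ad f)` to monic degree
`n` polynomials is a bijection: every monic polynomial of degree `n` is the
characteristic polynomial of a unique matrix `X` with `X - e ∈ ker (ad f)`. -/
theorem kostant_slodowy_slice_charpoly_bijective (n : ℕ) (hn : 1 ≤ n) :
    prinH n * prinE n - prinE n * prinH n = (2 : ℂ) • prinE n ∧
    prinH n * prinF n - prinF n * prinH n = (-2 : ℂ) • prinF n ∧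
    prinE n * prinF n - prinF n * prinE n = prinH n ∧
    ∀ p : Polynomial ℂ, p.Monic → p.natDegree = n →
      ∃! X : Matrix (Fin n) (Fin n) ℂ,
        (prinF n * (X - prinE n) = (X - prinE n) * prinF n) ∧
        X.charpoly = p := by
  refine ⟨prinH_commutator_prinE, prinH_commutator_prinF, prinE_commutator_prinF,
    fun p hp hpn => ?_⟩
  have : NeZero n := ⟨by omega⟩
  obtain ⟨a, ha⟩ := hessenbergPoly_surjective _ sum_prinWeight_ne_zero hp hpn
  refine ⟨prinE n + ∑ l ∈ Finset.range n, a l • prinF n ^ l, ⟨?_, ?_⟩, ?_⟩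
  · rw [add_sub_cancel_left]
    exact (Commute.sum_right _ _ _ fun l _ =>
      ((Commute.refl (prinF n)).pow_right l).smul_right (a l)).eq
  · rw [charpoly_prinE_add_sum, ha]
  · rintro X ⟨hcomm, hX⟩
    obtain ⟨b, hb⟩ := exists_sum_smul_prinF_pow hcomm
    obtain rfl : X = prinE n + ∑ l ∈ Finset.range n, b l • prinF n ^ l := by
      rw [← hb, add_sub_cancel]
    rw [charpoly_prinE_add_sum, ← ha] at hX
    have hba := hessenbergPoly_injective _ sum_prinWeight_ne_zero hX
    rw [Finset.sum_congr rfl fun l hl => by rw [hba l (Finset.mem_range.1 hl)]]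
end

section
/- Let n ≥ 1. For 0 ≤ i ≤ n−1 let X_i : ℂ^i → ℂ^{i+1} and Y_i : ℂ^{i+1} → ℂ^i be ℂ-linear maps (with ℂ⁰ = 0 the zero space). Assume the moment map relations X_{i−1} ∘ Y_{i−1} = Y_i ∘ X_i hold as endomorphisms of ℂ^i for all 1 ≤ i ≤ n−1. Then the endomorphism A = X_{n−1} ∘ Y_{n−1} of ℂⁿ is nilpotent; in fact A^n = 0. -/
/-- Powers of `f ∘ g` in terms of powers of `g ∘ f`. -/
theorem LinearMap.comp_pow_succ_eq_comp_pow_comp {R M N : Type*} [Semiring R]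
    [AddCommMonoid M] [AddCommMonoid N] [Module R M] [Module R N]
    (f : M →ₗ[R] N) (g : N →ₗ[R] M) (k : ℕ) :
    (f.comp g) ^ (k + 1) = f.comp (((g.comp f) ^ k).comp g) := by
  induction k with
  | zero => ext; simp
  | succ k ih =>
    rw [pow_succ, ih, pow_succ (g.comp f)]
    rfl

/-- Given linear maps `X i : ℂ^i → ℂ^{i+1}` and
`Y i : ℂ^{i+1} → ℂ^i` satisfying the moment map relations
`X_{i-1} ∘ Y_{i-1} = Y_i ∘ X_i` on `ℂ^i` for `1 ≤ i ≤ n-1` (written below with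
`i = j + 1`, `0 ≤ j ≤ n-2`), the endomorphism `A = X_{n-1} ∘ Y_{n-1}` of `ℂⁿ`
is nilpotent; in fact `A ^ n = 0`. -/
theorem quiver_chain_moment_map_nilpotent (n : ℕ) (hn : 1 ≤ n)
    (X : ∀ i : ℕ, (Fin i → ℂ) →ₗ[ℂ] (Fin (i + 1) → ℂ))
    (Y : ∀ i : ℕ, (Fin (i + 1) → ℂ) →ₗ[ℂ] (Fin i → ℂ))
    (hmom : ∀ j : ℕ, j + 2 ≤ n → (X j).comp (Y j) = (Y (j + 1)).comp (X (j + 1))) :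
    IsNilpotent ((X (n - 1)).comp (Y (n - 1))) ∧
      ((X (n - 1)).comp (Y (n - 1))) ^ n = 0 := by
  have key : ∀ k : ℕ, k + 1 ≤ n → ((X k).comp (Y k)) ^ (k + 1) = 0 := by
    intro k
    induction k with
    | zero =>
      intro _
      rw [Subsingleton.elim (Y 0) 0, LinearMap.comp_zero, zero_pow (by omega)]
    | succ j ih =>
      intro hj
      rw [LinearMap.comp_pow_succ_eq_comp_pow_comp, ← hmom j hj, ih (by omega),
        LinearMap.zero_comp, LinearMap.comp_zero]
  have hpow : ((X (n - 1)).comp (Y (n - 1))) ^ n = 0 := by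
    obtain ⟨m, rfl⟩ := Nat.exists_eq_add_of_le' hn
    exact key m le_rfl
  exact ⟨⟨n, hpow⟩, hpow⟩
end

section
/- Let n ≥ 1 and let v₀ = 0 ≤ v₁, …, v_n be nonnegative integers. For 0 ≤ i ≤ n−1 let X_i : ℂ^{v_i} → ℂ^{v_{i+1}} and Y_i : ℂ^{v_{i+1}} → ℂ^{v_i} be ℂ-linear maps, satisfying the moment map relations X_{i−1} ∘ Y_{i−1} = Y_i ∘ X_i as endomorphisms of ℂ^{v_i} for all 1 ≤ i ≤ n−1. Set A = X_{n−1} ∘ Y_{n−1}, an endomorphism of ℂ^{v_n}. Then for every 1 ≤ k ≤ n, the rank of A^k is at most v_{n−k}. In particular A^n = 0. -/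
/-- `(f ∘ g) ^ (k + 1) = f ∘ (g ∘ f) ^ k ∘ g`. -/
theorem LinearMap.comp_pow_succ_eq {R M N : Type*} [Semiring R] [AddCommMonoid M]
    [AddCommMonoid N] [Module R M] [Module R N] (f : M →ₗ[R] N) (g : N →ₗ[R] M) (k : ℕ) :
    (f ∘ₗ g) ^ (k + 1) = f ∘ₗ ((g ∘ₗ f) ^ k) ∘ₗ g := by
  induction k with
  | zero => ext; simp
  | succ k ih =>
    rw [pow_succ, ih, pow_succ]
    rfl

/-- Along a chain satisfying the moment map relations, the `k`-th power of `X m ∘ Y m`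
factors through the module `k` places before its own. -/
theorem exists_pow_eq_comp_of_moment_map {R : Type*} [Semiring R] {V : ℕ → Type*}
    [∀ i, AddCommMonoid (V i)] [∀ i, Module R (V i)]
    (X : ∀ i, V i →ₗ[R] V (i + 1)) (Y : ∀ i, V (i + 1) →ₗ[R] V i) (m : ℕ)
    (hmom : ∀ j < m, X j ∘ₗ Y j = Y (j + 1) ∘ₗ X (j + 1)) (k : ℕ) (hk : k ≤ m + 1) :
    ∃ (P : V (m + 1 - k) →ₗ[R] V (m + 1)) (Q : V (m + 1) →ₗ[R] V (m + 1 - k)),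
      (X m ∘ₗ Y m) ^ k = P ∘ₗ Q := by
  induction m generalizing k with
  | zero =>
    obtain rfl | rfl : k = 0 ∨ k = 1 := by omega
    · exact ⟨LinearMap.id, LinearMap.id, rfl⟩
    · exact ⟨X 0, Y 0, pow_one _⟩
  | succ m ih =>
    cases k with
    | zero => exact ⟨LinearMap.id, LinearMap.id, rfl⟩
    | succ k =>
      obtain ⟨P, Q, h⟩ := ih (fun j hj => hmom j (by omega)) k (by omega)
      rw [Nat.add_sub_add_right, LinearMap.comp_pow_succ_eq, ← hmom m (by omega), h]
      exact ⟨X (m + 1) ∘ₗ P, Q ∘ₗ Y (m + 1), rfl⟩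

/-- Given dimensions `v 0 = 0, v 1, …, v n` and linear maps
`X i : ℂ^{v i} → ℂ^{v (i+1)}`, `Y i : ℂ^{v (i+1)} → ℂ^{v i}` satisfying the
moment map relations `X_{i-1} ∘ Y_{i-1} = Y_i ∘ X_i` on `ℂ^{v i}` for
`1 ≤ i ≤ n-1` (written below with `i = j + 1`, `0 ≤ j ≤ n-2`), the
endomorphism `A = X_{n-1} ∘ Y_{n-1}` of `ℂ^{v n}` satisfies
`rank (A ^ k) ≤ v (n - k)` for all `1 ≤ k ≤ n`; in particular `A ^ n = 0`. -/
theorem quiver_chain_moment_map_rank_bound (n : ℕ) (hn : 1 ≤ n)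
    (v : ℕ → ℕ) (hv0 : v 0 = 0)
    (X : ∀ i : ℕ, (Fin (v i) → ℂ) →ₗ[ℂ] (Fin (v (i + 1)) → ℂ))
    (Y : ∀ i : ℕ, (Fin (v (i + 1)) → ℂ) →ₗ[ℂ] (Fin (v i) → ℂ))
    (hmom : ∀ j : ℕ, j + 2 ≤ n → (X j).comp (Y j) = (Y (j + 1)).comp (X (j + 1))) :
    (∀ k : ℕ, 1 ≤ k → k ≤ n →
      Module.finrank ℂ
          (LinearMap.range (((X (n - 1)).comp (Y (n - 1))) ^ k)) ≤ v (n - k)) ∧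
      ((X (n - 1)).comp (Y (n - 1))) ^ n = 0 := by
  obtain ⟨m, rfl⟩ : ∃ m, n = m + 1 := ⟨n - 1, by omega⟩
  have hfactor := exists_pow_eq_comp_of_moment_map X Y m fun j hj => hmom j (by omega)
  change (∀ k : ℕ, 1 ≤ k → k ≤ m + 1 →
      Module.finrank ℂ (LinearMap.range ((X m ∘ₗ Y m) ^ k)) ≤ v (m + 1 - k)) ∧
    (X m ∘ₗ Y m) ^ (m + 1) = 0
  constructor
  · intro k _ hk
    obtain ⟨P, Q, h⟩ := hfactor k hk
    rw [h]
    calc Module.finrank ℂ (LinearMap.range (P ∘ₗ Q))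
        ≤ Module.finrank ℂ (LinearMap.range P) :=
          Submodule.finrank_mono (LinearMap.range_comp_le_range Q P)
      _ ≤ Module.finrank ℂ (Fin (v (m + 1 - k)) → ℂ) := LinearMap.finrank_range_le P
      _ = v (m + 1 - k) := Module.finrank_fin_fun ℂ
  · obtain ⟨P, Q, h⟩ := hfactor (m + 1) le_rfl
    have : IsEmpty (Fin (v (m + 1 - (m + 1)))) := by
      rw [Nat.sub_self, hv0]
      infer_instance
    rw [h, Subsingleton.elim Q 0, LinearMap.comp_zero]
end

section
/- Let n ≥ 1 and let A be a nilpotent endomorphism of ℂⁿ (i.e. an n×n complex matrix with A^n = 0). Then there exist ℂ-linear maps X_i : ℂ^i → ℂ^{i+1} and Y_i : ℂ^{i+1} → ℂ^i for 0 ≤ i ≤ n−1 such that X_{i−1} ∘ Y_{i−1} = Y_i ∘ X_i holds on ℂ^i for all 1 ≤ i ≤ n−1, and A = X_{n−1} ∘ Y_{n−1}. -/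
/-- A nilpotent endomorphism of `K^(d+1)` factors through an injection `K^d → K^(d+1)`. -/
theorem IsNilpotent.exists_injective_comp_eq {K : Type*} [Field K] {d : ℕ}
    {A : Module.End K (Fin (d + 1) → K)} (hA : IsNilpotent A) :
    ∃ (X : (Fin d → K) →ₗ[K] (Fin (d + 1) → K)) (Y : (Fin (d + 1) → K) →ₗ[K] (Fin d → K)),
      Function.Injective X ∧ A = X ∘ₗ Y := by
  have hlt : LinearMap.range A < ⊤ := by
    rw [lt_top_iff_ne_top]
    intro htop
    have hunit : IsUnit A := (LinearMap.isUnit_iff_range_eq_top A).2 htop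
    exact hA.not_isUnit hunit
  obtain ⟨f, hf, hle⟩ := Submodule.exists_le_ker_of_lt_top _ hlt
  have hdim : Module.finrank K (LinearMap.ker f) = d := by
    have h := Module.Dual.finrank_ker_add_one_of_ne_zero (f := f) hf
    rw [Module.finrank_fin_fun] at h
    omega
  let e : (Fin d → K) ≃ₗ[K] LinearMap.ker f := LinearEquiv.ofFinrankEq _ _ (by simp [hdim])
  refine ⟨(LinearMap.ker f).subtype ∘ₗ e.toLinearMap,
    e.symm.toLinearMap ∘ₗ A.codRestrict _ fun v => hle (LinearMap.mem_range_self A v), ?_, ?_⟩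
  · exact (LinearMap.ker f).injective_subtype.comp e.injective
  · ext1
    simp [LinearMap.comp_assoc]

/-- If `X` is injective and `X ∘ Y` is nilpotent, then so is `Y ∘ X`. -/
theorem LinearMap.isNilpotent_comp_swap {R M N : Type*} [CommRing R] [AddCommGroup M]
    [AddCommGroup N] [Module R M] [Module R N] {X : M →ₗ[R] N} {Y : N →ₗ[R] M}
    (hX : Function.Injective X) (h : IsNilpotent (X ∘ₗ Y : Module.End R N)) :
    IsNilpotent (Y ∘ₗ X : Module.End R M) := by
  obtain ⟨k, hk⟩ := h
  have hcomm := Module.End.commute_pow_left_of_commute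
    (show (X ∘ₗ Y) ∘ₗ X = X ∘ₗ (Y ∘ₗ X) from LinearMap.comp_assoc _ _ _) k
  refine ⟨k, LinearMap.ext fun v => hX ?_⟩
  have hv := LinearMap.congr_fun hcomm v
  rw [hk] at hv
  simpa using hv.symm

theorem IsNilpotent.exists_quiver_chain {K : Type*} [Field K] (m : ℕ)
    (A : Module.End K (Fin (m + 1) → K)) (hA : IsNilpotent A) :
    ∃ (X : ∀ i : ℕ, (Fin i → K) →ₗ[K] (Fin (i + 1) → K))
      (Y : ∀ i : ℕ, (Fin (i + 1) → K) →ₗ[K] (Fin i → K)),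
      (∀ j : ℕ, j + 2 ≤ m + 1 → X j ∘ₗ Y j = Y (j + 1) ∘ₗ X (j + 1)) ∧ A = X m ∘ₗ Y m := by
  induction m with
  | zero => exact ⟨0, 0, by omega, by
      obtain ⟨X, Y, -, rfl⟩ := hA.exists_injective_comp_eq
      rw [Subsingleton.elim X 0]
      simp⟩
  | succ m ih =>
    obtain ⟨X, Y, hX, rfl⟩ := hA.exists_injective_comp_eq
    obtain ⟨X', Y', hrel, htop⟩ := ih (Y ∘ₗ X) (LinearMap.isNilpotent_comp_swap hX hA)
    refine ⟨Function.update X' (m + 1) X, Function.update Y' (m + 1) Y, fun j hj => ?_, by simp⟩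
    rcases (show j = m ∨ j < m by omega) with rfl | hjm
    · simp [← htop]
    · have hj₀ : j ≠ m + 1 := by omega
      have hj₁ : j + 1 ≠ m + 1 := by omega
      rw [Function.update_of_ne hj₀, Function.update_of_ne hj₀, Function.update_of_ne hj₁,
        Function.update_of_ne hj₁]
      exact hrel j (by omega)

/-- Every nilpotent endomorphism `A` of `ℂⁿ` (with `A ^ n = 0`,
`n = m + 1 ≥ 1`) arises as `A = X_{n-1} ∘ Y_{n-1}` for linear maps
`X i : ℂ^i → ℂ^{i+1}`, `Y i : ℂ^{i+1} → ℂ^i` satisfying the moment map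
relations `X_{i-1} ∘ Y_{i-1} = Y_i ∘ X_i` on `ℂ^i` for `1 ≤ i ≤ n-1`
(written below with `i = j + 1`, `0 ≤ j ≤ n-2`). -/
theorem nilpotent_is_quiver_chain_moment_map (m : ℕ)
    (A : (Fin (m + 1) → ℂ) →ₗ[ℂ] (Fin (m + 1) → ℂ))
    (hA : A ^ (m + 1) = 0) :
    ∃ (X : ∀ i : ℕ, (Fin i → ℂ) →ₗ[ℂ] (Fin (i + 1) → ℂ))
      (Y : ∀ i : ℕ, (Fin (i + 1) → ℂ) →ₗ[ℂ] (Fin i → ℂ)),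
      (∀ j : ℕ, j + 2 ≤ m + 1 → (X j).comp (Y j) = (Y (j + 1)).comp (X (j + 1))) ∧
      A = (X m).comp (Y m) := by
  exact IsNilpotent.exists_quiver_chain m A ⟨m + 1, hA⟩
end
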